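/- Let H0 be a hierarchy on [n] with induced triplet set T0, and let T be the random subset of T0 in which, independently for each pair of triplets {(i,j,k),(j,i,k)} ⊆ T0 with i<j, both triplets are included with probability p ∈ (0,1]. For any α > 0, if p > (α+2)·log n / n, then with probability at least 1 − n^{−α}, the deviation of the triplet revenue is bounded uniformly over all hierarchies: max_{H} |Trev(H, T) − p·Trev(H, T0)| < (4/3)·√((α+2)·p·n⁷·log n), where the maximum ranges over all hierarchies H on [n]. -/

import Mathlib

open Finset MeasureTheory

namespace CompHC

/-- A rooted binary tree with leaves labelled by elements of `Fin n`. -/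
inductive HTree (n : ℕ) : Type
  | leaf (i : Fin n) : HTree n
  | node (l r : HTree n) : HTree n

namespace HTree

/-- The list of leaf labels of a tree. -/
def leaves {n : ℕ} : HTree n → List (Fin n)
  | .leaf i => [i]
  | .node l r => l.leaves ++ r.leaves

/-- The number of leaves of a tree. -/
def size {n : ℕ} (t : HTree n) : ℕ := t.leaves.length

/-- `|H(i ∨ j)|`: the number of leaves of the smallest subtree containing both `i` and `j`. -/
def lcaSize {n : ℕ} : HTree n → Fin n → Fin n → ℕ
  | .leaf _, _, _ => 1
  | .node l r, i, j =>
      if i ∈ l.leaves ∧ j ∈ l.leaves then l.lcaSize i j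
      else if i ∈ r.leaves ∧ j ∈ r.leaves then r.lcaSize i j
      else l.size + r.size

/-- Sum of `f |N1| |N2|` over the internal nodes `N` of the tree, `N1, N2` its children. -/
def internalSum {n : ℕ} (f : ℕ → ℕ → ℕ) : HTree n → ℕ
  | .leaf _ => 0
  | .node l r => f l.size r.size + l.internalSum f + r.internalSum f

end HTree

/-- A hierarchy on `[n]`: every object appears exactly once as a leaf. -/
def IsHierarchy {n : ℕ} (t : HTree n) : Prop :=
  t.leaves.Nodup ∧ ∀ i : Fin n, i ∈ t.leaves

abbrev Triplet (n : ℕ) := Fin n × Fin n × Fin n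
abbrev Quadruplet (n : ℕ) := Fin n × Fin n × Fin n × Fin n

/-- The entries of a triplet are pairwise distinct. -/
def distinctTriplet {n : ℕ} (t : Triplet n) : Prop :=
  t.1 ≠ t.2.1 ∧ t.1 ≠ t.2.2 ∧ t.2.1 ≠ t.2.2

/-- A quadruplet `(i,j,k,l)` satisfies `i<j`, `k<l`, `(i,j) ≠ (k,l)`. -/
def validQuadruplet {n : ℕ} (q : Quadruplet n) : Prop :=
  q.1 < q.2.1 ∧ q.2.2.1 < q.2.2.2 ∧ (q.1, q.2.1) ≠ (q.2.2.1, q.2.2.2)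

/-- Triplet revenue `Trev(H,T) = Σ_{(i,j,k)∈T} (|H(i∨k)| − |H(i∨j)|)`. -/
def Trev {n : ℕ} (H : HTree n) (T : Finset (Triplet n)) : ℤ :=
  ∑ t ∈ T, ((H.lcaSize t.1 t.2.2 : ℤ) - (H.lcaSize t.1 t.2.1 : ℤ))

/-- Quadruplet revenue `Qrev(H,Q) = Σ_{(i,j,k,l)∈Q} (|H(k∨l)| − |H(i∨j)|)`. -/
def Qrev {n : ℕ} (H : HTree n) (Q : Finset (Quadruplet n)) : ℤ :=
  ∑ q ∈ Q, ((H.lcaSize q.2.2.1 q.2.2.2 : ℤ) - (H.lcaSize q.1 q.2.1 : ℤ))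

/-- The set of pairs `(i,j)` with `i < j`. -/
def pairs (n : ℕ) : Finset (Fin n × Fin n) :=
  Finset.univ.filter fun p => p.1 < p.2

/-- Dasgupta's cost `Dcost(H,s) = Σ_{i<j} s_{ij}·|H(i∨j)|`. -/
noncomputable def Dcost {n : ℕ} (H : HTree n) (s : Fin n → Fin n → ℝ) : ℝ :=
  ∑ p ∈ pairs n, s p.1 p.2 * (H.lcaSize p.1 p.2 : ℝ)

/-- The AddS3 similarity computed from a triplet set. -/
def sAddS3 {n : ℕ} (T : Finset (Triplet n)) (i j : Fin n) : ℤ :=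
  ∑ k ∈ Finset.univ.filter (fun k : Fin n => k ≠ i ∧ k ≠ j),
    (((if (i, j, k) ∈ T then 1 else 0) - (if (i, k, j) ∈ T then 1 else 0)
      + (if (j, i, k) ∈ T then 1 else 0) - (if (j, k, i) ∈ T then 1 else 0) : ℤ))

/-- The AddS4 similarity computed from a quadruplet set. -/
def sAddS4 {n : ℕ} (Q : Finset (Quadruplet n)) (i j : Fin n) : ℤ :=
  ∑ p ∈ (pairs n).filter (fun p => p ≠ (i, j)),
    (((if (i, j, p.1, p.2) ∈ Q then 1 else 0)
      - (if (p.1, p.2, i, j) ∈ Q then 1 else 0) : ℤ))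

/-- The triplet set induced by a hierarchy `H0`:
`T0 = {(i,j,k) : i,j,k pairwise distinct, |H0(i∨j)| < min(|H0(i∨k)|, |H0(j∨k)|)}`. -/
def inducedTriplets {n : ℕ} (H : HTree n) : Finset (Triplet n) :=
  Finset.univ.filter fun t : Triplet n =>
    t.1 ≠ t.2.1 ∧ t.1 ≠ t.2.2 ∧ t.2.1 ≠ t.2.2 ∧
    H.lcaSize t.1 t.2.1 < min (H.lcaSize t.1 t.2.2) (H.lcaSize t.2.1 t.2.2)


/-- Bernoulli measure on `Bool` with success probability `p`. -/
noncomputable def bern (p : ℝ) : Measure Bool :=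
  (ENNReal.ofReal p) • Measure.dirac true + (ENNReal.ofReal (1 - p)) • Measure.dirac false

/-- Product measure of i.i.d. Bernoulli(p) coins, one for each pair of triplets
`{(i,j,k),(j,i,k)}` (indexed by triplets; only keys `(i,j,k)` with `i ≤ j` are used). -/
noncomputable def sampleMeasure (n : ℕ) (p : ℝ) : Measure (Triplet n → Bool) :=
  Measure.pi fun _ => bern p

/-- The common key of the pair of triplets `{(i,j,k),(j,i,k)}`. -/
def pairKey {n : ℕ} (t : Triplet n) : Triplet n := (min t.1 t.2.1, max t.1 t.2.1, t.2.2)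

/-- The random subset `T ⊆ T0`: the pair `{(i,j,k),(j,i,k)}` is included iff its coin is true. -/
def sampledT {n : ℕ} (H0 : HTree n) (ω : Triplet n → Bool) : Finset (Triplet n) :=
  (inducedTriplets H0).filter fun t => ω (pairKey t) = true

/-- The key of the flipping coin `ζ^i_{jk}` for the triplets `(i,j,k)` and `(i,k,j)`. -/
def flipKey {n : ℕ} (t : Triplet n) : Triplet n := (t.1, min t.2.1 t.2.2, max t.2.1 t.2.2)

/-- Flipping a triplet: `(i,j,k) ↦ (i,k,j)`. -/
def flipTriplet {n : ℕ} (t : Triplet n) : Triplet n := (t.1, t.2.2, t.2.1)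

/-- Product measure: independent Bernoulli(p) sampling coins (left index) and
Bernoulli(δ) flipping coins (right index). -/
noncomputable def noisyMeasure (n : ℕ) (p δ : ℝ) :
    Measure ((Triplet n ⊕ Triplet n) → Bool) :=
  Measure.pi fun idx => Sum.elim (fun _ : Triplet n => bern p) (fun _ : Triplet n => bern δ) idx

/-- The noisy random triplet set `T'`: sample pairs from `T0` with probability `p`, then flip
each sampled triplet `(i,j,k)` to `(i,k,j)` independently with probability `δ`. -/
def noisySampledT {n : ℕ} (H0 : HTree n) (ω : (Triplet n ⊕ Triplet n) → Bool) :
    Finset (Triplet n) :=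
  ((inducedTriplets H0).filter fun t => ω (Sum.inl (pairKey t)) = true).image
    fun t => if ω (Sum.inr (flipKey t)) = true then flipTriplet t else t

lemma HTree.pos {n : ℕ} (H : HTree n) : 0 < n := by
  induction H with
  | leaf i => exact i.pos
  | node _ _ h _ => exact h

lemma HTree.lcaSize_comm {n : ℕ} (H : HTree n) (i j : Fin n) :
    H.lcaSize i j = H.lcaSize j i := by
  induction H with
  | leaf _ => rfl
  | node l r hl hr => simp only [lcaSize, hl, hr, and_comm]

lemma HTree.lcaSize_self {n : ℕ} (H : HTree n) (i : Fin n) (hi : i ∈ H.leaves) :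
    H.lcaSize i i = 1 := by
  induction H with
  | leaf _ => rfl
  | node l r hl hr =>
    simp only [leaves, List.mem_append] at hi
    by_cases h : i ∈ l.leaves
    · simp [lcaSize, h, hl h]
    · have h' := hi.resolve_left h
      simp [lcaSize, h, h', hr h']

/-- The sum of `|H(i ∨ j)|` over all ordered pairs of leaves, the diagonal included. -/
lemma HTree.sum_lcaSize_list {n : ℕ} (H : HTree n) (hH : H.leaves.Nodup) :
    3 * (H.leaves.map fun i => (H.leaves.map fun j => H.lcaSize i j).sum).sum
      = 2 * H.size ^ 3 + H.size := by
  induction H with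
  | leaf i => simp [leaves, size, lcaSize]
  | node l r hl hr =>
    simp only [leaves, List.nodup_append'] at hH
    obtain ⟨hln, hrn, hd⟩ := hH
    have hlr : ∀ i ∈ l.leaves, i ∉ r.leaves := fun i hi hi' => hd hi hi'
    have hll : ∀ i ∈ l.leaves,
        ((l.leaves ++ r.leaves).map fun j => (node l r).lcaSize i j).sum
          = (l.leaves.map fun j => l.lcaSize i j).sum + r.size * (l.size + r.size) := by
      intro i hi
      rw [List.map_append, List.sum_append]
      congr 1
      · refine congrArg List.sum (List.map_congr_left fun j hj => ?_)
        simp [lcaSize, hi, hj]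
      · rw [List.map_congr_left (g := fun _ => l.size + r.size)]
        · simp [size]
        · intro j hj
          have : j ∉ l.leaves := fun h => hlr j h hj
          simp [lcaSize, hlr i hi, this]
    have hrr : ∀ i ∈ r.leaves,
        ((l.leaves ++ r.leaves).map fun j => (node l r).lcaSize i j).sum
          = l.size * (l.size + r.size) + (r.leaves.map fun j => r.lcaSize i j).sum := by
      intro i hi
      have hil : i ∉ l.leaves := fun h => hlr i h hi
      rw [List.map_append, List.sum_append]
      congr 1
      · rw [List.map_congr_left (g := fun _ => l.size + r.size)]
        · simp [size]
        · intro j hj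
          simp [lcaSize, hlr j hj, hil]
      · refine congrArg List.sum (List.map_congr_left fun j hj => ?_)
        simp [lcaSize, hil, hi, hj]
    have hsize : (node l r).size = l.size + r.size := by simp [size, leaves]
    rw [hsize, leaves, List.map_append, List.sum_append, List.map_congr_left hll,
      List.map_congr_left hrr, List.sum_map_add, List.sum_map_add]
    have h1 := hl hln
    have h2 := hr hrn
    simp only [List.map_const', List.sum_replicate, smul_eq_mul]
    change 3 * (_ + l.size * _ + (r.size * _ + _)) = _
    linear_combination h1 + h2

lemma IsHierarchy.toFinset_leaves {n : ℕ} {H : HTree n} (hH : IsHierarchy H) :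
    H.leaves.toFinset = Finset.univ := by
  ext i
  simp [hH.2 i]

lemma IsHierarchy.size_eq {n : ℕ} {H : HTree n} (hH : IsHierarchy H) : H.size = n := by
  rw [HTree.size, ← List.toFinset_card_of_nodup hH.1, hH.toFinset_leaves, Finset.card_fin]

lemma IsHierarchy.sum_lcaSize {n : ℕ} {H : HTree n} (hH : IsHierarchy H) :
    3 * ∑ i, ∑ j, H.lcaSize i j = 2 * n ^ 3 + n := by
  have h := H.sum_lcaSize_list hH.1
  rw [hH.size_eq] at h
  rw [← h, ← hH.toFinset_leaves, List.sum_toFinset _ hH.1]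
  simp only [List.sum_toFinset _ hH.1]

/-- The sum of `|H(i ∨ j)|` over all ordered pairs of distinct objects. -/
lemma IsHierarchy.sum_lcaSize_offDiag {n : ℕ} {H : HTree n} (hH : IsHierarchy H) :
    ∑ i, ∑ j, (if i = j then 0 else (H.lcaSize i j : ℝ)) = 2 / 3 * ((n : ℝ) ^ 3 - n) := by
  have h : (3 : ℝ) * ∑ i, ∑ j, (H.lcaSize i j : ℝ) = 2 * n ^ 3 + n := by
    exact_mod_cast hH.sum_lcaSize
  have hrow : ∀ i, ∑ j, (if i = j then 0 else (H.lcaSize i j : ℝ))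
      = ∑ j, (H.lcaSize i j : ℝ) - 1 := by
    intro i
    have : ∀ j, (if i = j then 0 else (H.lcaSize i j : ℝ))
        = (H.lcaSize i j : ℝ) - if i = j then 1 else 0 := by
      intro j
      split_ifs with hij
      · subst hij
        simp [H.lcaSize_self i (hH.2 i)]
      · simp
    simp [this]
  simp only [hrow, Finset.sum_sub_distrib]
  simp only [Finset.sum_const, Finset.card_univ, Fintype.card_fin, nsmul_eq_mul, mul_one]
  linarith

/-- The centred value of a Bernoulli(`p`) coin. -/
noncomputable def centredCoin (p : ℝ) (b : Bool) : ℝ := (if b = true then 1 else 0) - p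

lemma isProbabilityMeasure_bern {p : ℝ} (hp0 : 0 ≤ p) (hp1 : p ≤ 1) :
    IsProbabilityMeasure (bern p) := by
  constructor
  simp [bern, ← ENNReal.ofReal_add hp0 (sub_nonneg.2 hp1)]

lemma isProbabilityMeasure_sampleMeasure (n : ℕ) {p : ℝ} (hp0 : 0 ≤ p) (hp1 : p ≤ 1) :
    IsProbabilityMeasure (sampleMeasure n p) := by
  have := isProbabilityMeasure_bern hp0 hp1
  unfold sampleMeasure
  infer_instance

lemma integral_bern {p : ℝ} (hp0 : 0 ≤ p) (hp1 : p ≤ 1) (f : Bool → ℝ) :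
    ∫ b, f b ∂bern p = p * f true + (1 - p) * f false := by
  have := isProbabilityMeasure_bern hp0 hp1
  rw [bern, integral_add_measure, integral_smul_measure, integral_smul_measure]
  · simp [ENNReal.toReal_ofReal hp0, ENNReal.toReal_ofReal (sub_nonneg.2 hp1)]
  · exact (Integrable.of_finite).smul_measure ENNReal.ofReal_ne_top
  · exact (Integrable.of_finite).smul_measure ENNReal.ofReal_ne_top

lemma integral_exp_centredCoin_le {p : ℝ} (hp0 : 0 ≤ p) (hp1 : p ≤ 1) {s x : ℝ}
    (hs : |s| ≤ x) (hx : x ≤ 1) :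
    ∫ b, Real.exp (s * centredCoin p b) ∂bern p ≤ Real.exp (p * x ^ 2) := by
  rw [integral_bern hp0 hp1]
  have h1 : Real.exp s - 1 - s ≤ x ^ 2 :=
    (le_abs_self _).trans <| (Real.abs_exp_sub_one_sub_id_le (hs.trans hx)).trans <|
      sq_le_sq' (abs_le.1 hs).1 (abs_le.1 hs).2
  have h2 : p * Real.exp (s * centredCoin p true) + (1 - p) * Real.exp (s * centredCoin p false)
      = Real.exp (-(s * p)) * (p * (Real.exp s - 1) + 1) := by
    have : Real.exp (s * centredCoin p true) = Real.exp (-(s * p)) * Real.exp s := by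
      rw [← Real.exp_add]
      congr 1
      simp [centredCoin]
      ring
    rw [this]
    simp [centredCoin]
    ring
  rw [h2]
  calc _ ≤ Real.exp (-(s * p)) * Real.exp (p * (Real.exp s - 1)) := by
        gcongr
        exact Real.add_one_le_exp _
    _ = Real.exp (p * (Real.exp s - 1 - s)) := by
        rw [← Real.exp_add]
        ring_nf
    _ ≤ _ := by gcongr

/-- Chernoff bound for a linear combination of distinct centred coins. -/
lemma sampleMeasure_tail {n : ℕ} {p : ℝ} (hp0 : 0 ≤ p) (hp1 : p ≤ 1) {K : Fin n → Triplet n}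
    (hK : Function.Injective K) {c : Fin n → ℝ} (hc : ∀ k, |c k| ≤ 2) {x : ℝ} (hx0 : 0 ≤ x)
    (hx1 : x ≤ 1) :
    (sampleMeasure n p).real {ω | 4 * (p * n * x) ≤ ∑ k, c k * centredCoin p (ω (K k))}
      ≤ Real.exp (-(p * n * x ^ 2)) := by
  have := isProbabilityMeasure_bern hp0 hp1
  have := isProbabilityMeasure_sampleMeasure n hp0 hp1
  let X : Fin n → (Triplet n → Bool) → ℝ := fun k ω => c k * centredCoin p (ω (K k))
  have hcoins : ProbabilityTheory.iIndepFun (fun q (ω : Triplet n → Bool) => ω q)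
      (sampleMeasure n p) :=
    ProbabilityTheory.iIndepFun_pi (X := fun _ b => b) fun _ => aemeasurable_id
  have hX : ProbabilityTheory.iIndepFun X (sampleMeasure n p) :=
    (hcoins.precomp hK).comp (fun k b => c k * centredCoin p b) fun _ => .of_discrete
  have hmgf : ∀ k, ProbabilityTheory.mgf (X k) (sampleMeasure n p) (x / 2)
      ≤ Real.exp (p * x ^ 2) := by
    intro k
    have hint : ProbabilityTheory.mgf (X k) (sampleMeasure n p) (x / 2)
        = ∫ b, Real.exp (x / 2 * c k * centredCoin p b) ∂bern p := by
      have hmap : (sampleMeasure n p).map (Function.eval (K k)) = bern p :=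
        (measurePreserving_eval (fun _ => bern p) (K k)).map_eq
      rw [← hmap, integral_map (measurable_pi_apply _).aemeasurable .of_discrete]
      simp only [ProbabilityTheory.mgf, X, mul_assoc]
    rw [hint]
    refine integral_exp_centredCoin_le hp0 hp1 ?_ hx1
    rw [abs_mul, abs_of_nonneg (by positivity)]
    nlinarith [hc k]
  have h := ProbabilityTheory.measure_ge_le_exp_mul_mgf (μ := sampleMeasure n p)
    (X := ∑ k, X k) (t := x / 2) (4 * (p * n * x)) (by positivity) .of_finite
  rw [hX.mgf_sum (fun k => .of_discrete)] at h
  simp only [Finset.sum_apply] at h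
  refine h.trans ?_
  calc _ ≤ Real.exp (-(x / 2) * (4 * (p * n * x))) * ∏ _k : Fin n, Real.exp (p * x ^ 2) := by
        gcongr with k
        · exact fun _ _ => ProbabilityTheory.mgf_nonneg
        · exact hmgf k
    _ = _ := by
        rw [Finset.prod_const, Finset.card_univ, Fintype.card_fin, ← Real.exp_nat_mul,
          ← Real.exp_add]
        ring_nf

lemma pairKey_swap {n : ℕ} (i j k : Fin n) : pairKey (j, i, k) = pairKey (i, j, k) := by
  simp [pairKey, min_comm, max_comm]

lemma pairKey_sum {n : ℕ} (t : Triplet n) :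
    ((pairKey t).1 : ℕ) + (pairKey t).2.1 + (pairKey t).2.2 = t.1 + t.2.1 + t.2.2 := by
  rcases le_total t.1 t.2.1 with h | h
  · simp [pairKey, h]
  · simp [pairKey, h, add_comm (t.1 : ℕ)]

lemma mem_inducedTriplets_swap {n : ℕ} {H : HTree n} {i j k : Fin n} :
    (j, i, k) ∈ inducedTriplets H ↔ (i, j, k) ∈ inducedTriplets H := by
  simp only [inducedTriplets, Finset.mem_filter, Finset.mem_univ, true_and, H.lcaSize_comm j i,
    lt_min_iff, ne_comm (a := j) (b := i)]
  tauto

lemma notMem_inducedTriplets_of_mem {n : ℕ} {H : HTree n} {i j k : Fin n}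
    (h : (i, j, k) ∈ inducedTriplets H) : (i, k, j) ∉ inducedTriplets H := by
  simp only [inducedTriplets, Finset.mem_filter, Finset.mem_univ, true_and, lt_min_iff] at h ⊢
  omega

/-- The deviation from its mean of the indicator of `t ∈ T`. -/
noncomputable def tripletDev {n : ℕ} (H0 : HTree n) (p : ℝ) (ω : Triplet n → Bool)
    (t : Triplet n) : ℝ :=
  if t ∈ inducedTriplets H0 then centredCoin p (ω (pairKey t)) else 0

/-- The deviation from its mean of the (negated) AddS3 similarity of `i` and `j`. -/
noncomputable def simDev {n : ℕ} (H0 : HTree n) (p : ℝ) (ω : Triplet n → Bool)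
    (i j : Fin n) : ℝ :=
  ∑ k, (tripletDev H0 p ω (i, k, j) + tripletDev H0 p ω (j, k, i)
    - 2 * tripletDev H0 p ω (i, j, k))

lemma tripletDev_swap {n : ℕ} (H0 : HTree n) (p : ℝ) (ω : Triplet n → Bool) (i j k : Fin n) :
    tripletDev H0 p ω (j, i, k) = tripletDev H0 p ω (i, j, k) := by
  simp only [tripletDev, mem_inducedTriplets_swap (i := i) (j := j), pairKey_swap i j k]

lemma simDev_comm {n : ℕ} (H0 : HTree n) (p : ℝ) (ω : Triplet n → Bool) (i j : Fin n) :
    simDev H0 p ω i j = simDev H0 p ω j i := by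
  simp only [simDev, tripletDev_swap H0 p ω i j]
  exact Finset.sum_congr rfl fun k _ => by ring

lemma trev_sub_eq_sum_tripletDev {n : ℕ} (H0 H : HTree n) (p : ℝ) (ω : Triplet n → Bool) :
    (Trev H (sampledT H0 ω) : ℝ) - p * (Trev H (inducedTriplets H0) : ℝ)
      = ∑ i, ∑ j, ∑ k, tripletDev H0 p ω (i, j, k)
          * ((H.lcaSize i k : ℝ) - (H.lcaSize i j : ℝ)) := by
  have h : ∑ i, ∑ j, ∑ k, tripletDev H0 p ω (i, j, k)
          * ((H.lcaSize i k : ℝ) - (H.lcaSize i j : ℝ))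
      = ∑ t : Triplet n, tripletDev H0 p ω t
          * ((H.lcaSize t.1 t.2.2 : ℝ) - (H.lcaSize t.1 t.2.1 : ℝ)) := by
    simp only [Fintype.sum_prod_type]
  rw [h]
  simp only [tripletDev, ite_mul, zero_mul, Finset.sum_ite_mem, Finset.univ_inter, Trev, sampledT,
    Finset.sum_filter, centredCoin, Int.cast_sum, Finset.mul_sum, ← Finset.sum_sub_distrib]
  refine Finset.sum_congr rfl fun t _ => ?_
  split_ifs <;> push_cast <;> ring

lemma two_mul_trev_sub_eq {n : ℕ} (H0 H : HTree n) (p : ℝ) (ω : Triplet n → Bool) :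
    2 * ((Trev H (sampledT H0 ω) : ℝ) - p * (Trev H (inducedTriplets H0) : ℝ))
      = ∑ i, ∑ j, (if i = j then 0 else (H.lcaSize i j : ℝ)) * simDev H0 p ω i j := by
  set D := tripletDev H0 p ω with hD
  let R : Fin n → Fin n → ℝ := fun i j => ∑ k, (D (i, k, j) - D (i, j, k))
  have hE : (Trev H (sampledT H0 ω) : ℝ) - p * (Trev H (inducedTriplets H0) : ℝ)
      = ∑ i, ∑ j, (H.lcaSize i j : ℝ) * R i j := by
    rw [trev_sub_eq_sum_tripletDev]
    refine Finset.sum_congr rfl fun i _ => ?_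
    simp only [R, mul_sub, Finset.sum_sub_distrib, Finset.mul_sum]
    rw [Finset.sum_comm]
    simp only [mul_comm, hD]
  have hE' : (Trev H (sampledT H0 ω) : ℝ) - p * (Trev H (inducedTriplets H0) : ℝ)
      = ∑ i, ∑ j, (H.lcaSize i j : ℝ) * R j i := by
    rw [hE, Finset.sum_comm]
    simp only [H.lcaSize_comm]
  have hS : ∀ i j, simDev H0 p ω i j = R i j + R j i := by
    intro i j
    simp only [R, simDev, ← Finset.sum_add_distrib, hD, tripletDev_swap H0 p ω i j]
    exact Finset.sum_congr rfl fun k _ => by ring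
  have hdiag : ∀ i, simDev H0 p ω i i = 0 := by
    intro i
    simp [simDev, tripletDev, inducedTriplets]
  rw [two_mul]
  nth_rw 1 [hE]
  rw [hE']
  simp only [← Finset.sum_add_distrib, ← mul_add, ← hS]
  refine Finset.sum_congr rfl fun i _ => Finset.sum_congr rfl fun j _ => ?_
  split_ifs with hij
  · subst hij
    simp [hdiag]
  · rfl

lemma exists_simDev_eq {n : ℕ} (H0 : HTree n) (p : ℝ) (i j : Fin n) :
    ∃ K : Fin n → Triplet n, Function.Injective K ∧ ∃ c : Fin n → ℝ, (∀ k, |c k| ≤ 2) ∧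
      ∀ ω, simDev H0 p ω i j = ∑ k, c k * centredCoin p (ω (K k)) := by
  classical
  let t : Fin n → Triplet n := fun k =>
    if (i, k, j) ∈ inducedTriplets H0 then (i, k, j)
    else if (j, k, i) ∈ inducedTriplets H0 then (j, k, i) else (i, j, k)
  let c : Fin n → ℝ := fun k =>
    if (i, k, j) ∈ inducedTriplets H0 then 1
    else if (j, k, i) ∈ inducedTriplets H0 then 1
    else if (i, j, k) ∈ inducedTriplets H0 then -2 else 0
  have ht : ∀ k, ((t k).1 : ℕ) + (t k).2.1 + (t k).2.2 = i + j + k := by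
    intro k
    simp only [t]
    split_ifs <;> simp <;> omega
  refine ⟨fun k => pairKey (t k), fun k l hkl => ?_, c, fun k => ?_, fun ω => ?_⟩
  · have hk := pairKey_sum (t k)
    have hl := pairKey_sum (t l)
    simp only at hkl
    rw [hkl, hl, ht, ht] at hk
    exact Fin.ext (by omega)
  · simp only [c]
    split_ifs <;> norm_num
  · refine Finset.sum_congr rfl fun k _ => ?_
    by_cases h1 : (i, k, j) ∈ inducedTriplets H0
    · have h2 : (j, k, i) ∉ inducedTriplets H0 := fun h =>
        notMem_inducedTriplets_of_mem (mem_inducedTriplets_swap.1 h)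
          (mem_inducedTriplets_swap.1 h1)
      simp [tripletDev, c, t, h1, h2, notMem_inducedTriplets_of_mem h1]
    · by_cases h2 : (j, k, i) ∈ inducedTriplets H0
      · have h3 : (i, j, k) ∉ inducedTriplets H0 := fun h =>
          notMem_inducedTriplets_of_mem h2 (mem_inducedTriplets_swap.1 h)
        simp [tripletDev, c, t, h1, h2, h3]
      · by_cases h3 : (i, j, k) ∈ inducedTriplets H0 <;> simp [tripletDev, c, t, h1, h2, h3]

lemma sampleMeasure_simDev_tail {n : ℕ} (H0 : HTree n) {p : ℝ} (hp0 : 0 ≤ p) (hp1 : p ≤ 1)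
    {x : ℝ} (hx0 : 0 ≤ x) (hx1 : x ≤ 1) (i j : Fin n) :
    (sampleMeasure n p).real {ω | 4 * (p * n * x) ≤ |simDev H0 p ω i j|}
      ≤ 2 * Real.exp (-(p * n * x ^ 2)) := by
  have := isProbabilityMeasure_sampleMeasure n hp0 hp1
  obtain ⟨K, hK, c, hc, hS⟩ := exists_simDev_eq H0 p i j
  have h1 := sampleMeasure_tail hp0 hp1 hK hc hx0 hx1
  have h2 := sampleMeasure_tail hp0 hp1 hK (c := fun k => -c k) (by simpa using hc) hx0 hx1
  simp only [neg_mul, Finset.sum_neg_distrib, ← hS] at h1 h2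
  simp only [le_abs, Set.ofPred_or]
  linarith [measureReal_union_le (μ := sampleMeasure n p)
    {ω | 4 * (p * n * x) ≤ simDev H0 p ω i j} {ω | 4 * (p * n * x) ≤ -simDev H0 p ω i j}]

lemma two_mul_card_pairs_le (n : ℕ) : 2 * (pairs n).card ≤ n ^ 2 := by
  have h : ((pairs n) ∪ (pairs n).map (Equiv.prodComm _ _).toEmbedding).card
      = 2 * (pairs n).card := by
    rw [Finset.card_union_of_disjoint, Finset.card_map, two_mul]
    rw [Finset.disjoint_left]
    rintro ⟨a, b⟩ h1 h2
    simp only [pairs, Finset.mem_map_equiv, Finset.mem_filter, Finset.mem_univ, true_and] at h1 h2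
    exact lt_asymm h1 h2
  rw [← h]
  refine (Finset.card_le_univ _).trans_eq ?_
  simp [sq]

lemma sampleMeasure_exists_simDev_tail {n : ℕ} (H0 : HTree n) {p : ℝ} (hp0 : 0 ≤ p)
    (hp1 : p ≤ 1) {x : ℝ} (hx0 : 0 ≤ x) (hx1 : x ≤ 1) :
    (sampleMeasure n p).real {ω | ∃ i j, i ≠ j ∧ 4 * (p * n * x) ≤ |simDev H0 p ω i j|}
      ≤ n ^ 2 * Real.exp (-(p * n * x ^ 2)) := by
  have := isProbabilityMeasure_sampleMeasure n hp0 hp1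
  have hsub : {ω | ∃ i j, i ≠ j ∧ 4 * (p * n * x) ≤ |simDev H0 p ω i j|}
      ⊆ ⋃ q ∈ pairs n, {ω | 4 * (p * n * x) ≤ |simDev H0 p ω q.1 q.2|} := by
    rintro ω ⟨i, j, hij, h⟩
    simp only [Set.mem_iUnion, pairs, Finset.mem_filter, Finset.mem_univ, true_and]
    rcases lt_or_gt_of_ne hij with hlt | hlt
    · exact ⟨(i, j), hlt, h⟩
    · exact ⟨(j, i), hlt, by rwa [Set.mem_ofPred_eq, simDev_comm]⟩
  have hcard : (2 : ℝ) * (pairs n).card ≤ n ^ 2 := by exact_mod_cast two_mul_card_pairs_le n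
  calc _ ≤ _ := measureReal_mono hsub (measure_ne_top _ _)
    _ ≤ _ := measureReal_biUnion_finset_le _ _
    _ ≤ ∑ _q ∈ pairs n, 2 * Real.exp (-(p * n * x ^ 2)) :=
        Finset.sum_le_sum fun q _ => sampleMeasure_simDev_tail H0 hp0 hp1 hx0 hx1 q.1 q.2
    _ = 2 * (pairs n).card * Real.exp (-(p * n * x ^ 2)) := by
        rw [Finset.sum_const, nsmul_eq_mul]
        ring
    _ ≤ _ := by gcongr

lemma abs_trev_sub_le {n : ℕ} (H0 : HTree n) {H : HTree n} (hH : IsHierarchy H) {p τ : ℝ}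
    {ω : Triplet n → Bool} (hω : ∀ i j, i ≠ j → |simDev H0 p ω i j| ≤ τ) :
    |(Trev H (sampledT H0 ω) : ℝ) - p * (Trev H (inducedTriplets H0) : ℝ)|
      ≤ 1 / 3 * ((n : ℝ) ^ 3 - n) * τ := by
  have h : |2 * ((Trev H (sampledT H0 ω) : ℝ) - p * (Trev H (inducedTriplets H0) : ℝ))|
      ≤ 2 / 3 * ((n : ℝ) ^ 3 - n) * τ := by
    rw [two_mul_trev_sub_eq, ← hH.sum_lcaSize_offDiag, Finset.sum_mul]
    refine (Finset.abs_sum_le_sum_abs _ _).trans (Finset.sum_le_sum fun i _ => ?_)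
    rw [Finset.sum_mul]
    refine (Finset.abs_sum_le_sum_abs _ _).trans (Finset.sum_le_sum fun j _ => ?_)
    split_ifs with hij
    · simp
    · rw [abs_mul, Nat.abs_cast]
      gcongr
      exact hω i j hij
  rw [abs_mul, abs_two] at h
  linarith

/-- with probability `≥ 1 − n^{−α}`, uniformly over all hierarchies `H`,
`|Trev(H,T) − p·Trev(H,T0)| < (4/3)·√((α+2)·p·n⁷·log n)`. -/
theorem sampled_trev_uniform_deviation {n : ℕ} (H0 : HTree n) (hH0 : IsHierarchy H0)
    (p : ℝ) (hp0 : 0 < p) (hp1 : p ≤ 1) (α : ℝ) (hα : 0 < α)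
    (hpn : p > (α + 2) * Real.log n / n) :
    ENNReal.ofReal (1 - (n : ℝ) ^ (-α)) ≤
      sampleMeasure n p {ω |
        ∀ H : HTree n, IsHierarchy H →
          |((Trev H (sampledT H0 ω) : ℝ)) - p * (Trev H (inducedTriplets H0) : ℝ)| <
            (4 / 3) * Real.sqrt ((α + 2) * p * (n : ℝ) ^ 7 * Real.log n)} := by
  have hn : 0 < n := H0.pos
  rcases Nat.lt_or_ge 1 n with hn1 | hn1
  swap
  · obtain rfl : n = 1 := by omega
    simp
  have := isProbabilityMeasure_sampleMeasure n hp0.le hp1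
  have hn0 : (0 : ℝ) < n := by exact_mod_cast hn
  have hL : 0 < Real.log n := Real.log_pos (by exact_mod_cast hn1)
  set y := (α + 2) * Real.log n / (p * n) with hy
  have hy0 : 0 < y := by positivity
  have hy1 : y ≤ 1 := by
    rw [hy, div_le_one (by positivity)]
    exact ((div_lt_iff₀ hn0).1 hpn).le
  set x := √y with hx
  have hx0 : 0 < x := Real.sqrt_pos.2 hy0
  have hx1 : x ≤ 1 := Real.sqrt_le_one.2 hy1
  have hpnx : p * n * x ^ 2 = (α + 2) * Real.log n := by
    rw [hx, Real.sq_sqrt hy0.le, hy]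
    field_simp
  have hbad := sampleMeasure_exists_simDev_tail H0 hp0.le hp1 hx0.le hx1
  have hexp : (n : ℝ) ^ 2 * Real.exp (-(p * n * x ^ 2)) = (n : ℝ) ^ (-α) := by
    rw [hpnx, Real.rpow_def_of_pos hn0]
    nth_rw 1 [← Real.exp_log hn0]
    rw [← Real.exp_nat_mul, ← Real.exp_add]
    push_cast
    ring_nf
  rw [hexp] at hbad
  have hsqrt : Real.sqrt ((α + 2) * p * (n : ℝ) ^ 7 * Real.log n) = p * n * x * n ^ 3 := by
    rw [Real.sqrt_eq_iff_mul_self_eq_of_pos (by positivity)]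
    linear_combination p * n ^ 7 * hpnx
  set bad := {ω | ∃ i j, i ≠ j ∧ 4 * (p * n * x) ≤ |simDev H0 p ω i j|}
  have hgood : ENNReal.ofReal (1 - (n : ℝ) ^ (-α)) ≤ sampleMeasure n p badᶜ := by
    have hmeas : MeasurableSet bad := (Set.toFinite bad).measurableSet
    rw [← ofReal_measureReal]
    refine ENNReal.ofReal_le_ofReal ?_
    rw [probReal_compl_eq_one_sub hmeas]
    linarith
  refine hgood.trans (measure_mono fun ω hω H hH => ?_)
  have hω' : ∀ i j, i ≠ j → |simDev H0 p ω i j| ≤ 4 * (p * n * x) := by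
    intro i j hij
    by_contra! h
    exact hω ⟨i, j, hij, h.le⟩
  refine (abs_trev_sub_le H0 hH hω').trans_lt ?_
  rw [hsqrt]
  have : 0 < p * n * x * n := by positivity
  linarith

end CompHC
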